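/- arXiv:2003.03478 — 2 statements merged into one kernel-verified Lean document; each statement's English description precedes it below -/
import Mathlib

section
/- Let L > 0 and Ra ∈ ℝ. Let a : ℤ³ → ℂ satisfy a(k) = 0 whenever k₁² + k₂² = 0, and for k with k₁² + k₂² ≠ 0 define û(k) = Ra · (−(k₂/L) k₃ / (k₃² + κ_k³)) · a(k), v̂(k) = Ra · ((k₁/L) k₃ / (k₃² + κ_k³)) · a(k), and ŵ(k) = Ra · (κ_k² / (k₃² + κ_k³)) · a(k), all zero otherwise. Then: (i) if Σ κ_k² |a(k)|² < ∞, then Σ_{k∈ℤ³} κ_k k₃² ( |û(k)|² + |v̂(k)|² + |ŵ(k)|² ) ≤ 2 Ra² Σ_{k∈ℤ³} κ_k² |a(k)|²; and (ii) if Σ κ_k k₃² |a(k)|² < ∞, then Σ_{k∈ℤ³} k₃⁴ ( |û(k)|² + |v̂(k)|² + |ŵ(k)|² ) ≤ 2 Ra² Σ_{k∈ℤ³} κ_k k₃² |a(k)|². -/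
noncomputable section
open Real

/-- For `k = (k₁,k₂,k₃) ∈ ℤ³`, `κ_k = (k₁² + k₂²)/L²`. -/
def kappa (L : ℝ) (k : ℤ × ℤ × ℤ) : ℝ := ((k.1^2 + k.2.1^2 : ℤ) : ℝ) / L^2

theorem kappa_nonneg (L : ℝ) (k : ℤ × ℤ × ℤ) : 0 ≤ kappa L k := by
  unfold kappa
  push_cast
  positivity

theorem kappa_pos {L : ℝ} (hL : 0 < L) {k : ℤ × ℤ × ℤ} (hk : k.1^2 + k.2.1^2 ≠ 0) :
    0 < kappa L k := by
  have h : 0 < k.1^2 + k.2.1^2 := lt_of_le_of_ne (by positivity) hk.symm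
  have h' : (0 : ℝ) < ((k.1^2 + k.2.1^2 : ℤ) : ℝ) := by exact_mod_cast h
  unfold kappa
  positivity

/-- The squared Fourier multipliers of the three velocity components add up to
`R² κ / (p² + κ³)`, so that `p²` times their sum is at most `R² κ`. -/
theorem sq_mul_multipliers_le {R x y p κ : ℝ} (hκ : 0 < κ) (hxy : x^2 + y^2 = κ) :
    p^2 * ((R * (-y * p / (p^2 + κ^3)))^2 + (R * (x * p / (p^2 + κ^3)))^2
      + (R * (κ^2 / (p^2 + κ^3)))^2) ≤ R^2 * κ := by
  have hD : 0 < p^2 + κ^3 := by positivity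
  have hsum : (R * (-y * p / (p^2 + κ^3)))^2 + (R * (x * p / (p^2 + κ^3)))^2
      + (R * (κ^2 / (p^2 + κ^3)))^2 = R^2 * κ / (p^2 + κ^3) := by
    field_simp
    linear_combination R^2 * p^2 * hxy
  rw [hsum, ← mul_div_assoc, div_le_iff₀ hD]
  nlinarith [show 0 ≤ R^2 * κ * κ^3 by positivity]

theorem norm_ofReal_mul_sq (r : ℝ) (z : ℂ) : ‖(r : ℂ) * z‖^2 = r^2 * ‖z‖^2 := by
  rw [norm_mul, mul_pow, Complex.norm_real, Real.norm_eq_abs, sq_abs]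

theorem tsum_le_two_mul_sq_mul_tsum {ι : Type*} {f g : ι → ℝ} (R : ℝ) (hf : ∀ i, 0 ≤ f i)
    (hg : ∀ i, 0 ≤ g i) (hfg : ∀ i, f i ≤ R^2 * g i) (hs : Summable g) :
    ∑' i, f i ≤ 2 * R^2 * ∑' i, g i := by
  have hs' : Summable fun i => R^2 * g i := hs.mul_left _
  have h := (Summable.of_nonneg_of_le hf hfg hs').tsum_le_tsum hfg hs'
  rw [tsum_mul_left] at h
  have h0 : 0 ≤ R^2 * ∑' i, g i := mul_nonneg (sq_nonneg R) (tsum_nonneg hg)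
  linarith

/-- Fourier-coefficient form of the estimates
(i) `‖∇_h ∂_z (u,v,w)‖₂² ≤ 2 Ra² ‖Δ_h θ'‖₂²` and (ii) `‖∂²_z (u,v,w)‖₂² ≤ 2 Ra² ‖∇_h ∂_z θ'‖₂²`. -/
theorem higher_velocity_estimates (L Ra : ℝ) (hL : 0 < L)
    (a u v w : ℤ × ℤ × ℤ → ℂ)
    (ha0 : ∀ k : ℤ × ℤ × ℤ, k.1^2 + k.2.1^2 = 0 → a k = 0)
    (hu : ∀ k : ℤ × ℤ × ℤ, u k =
      if k.1^2 + k.2.1^2 ≠ 0 then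
        ((Ra * (-((k.2.1:ℝ)/L) * (k.2.2:ℝ) / (((k.2.2:ℝ))^2 + kappa L k ^ 3)) : ℝ) : ℂ) * a k
      else 0)
    (hv : ∀ k : ℤ × ℤ × ℤ, v k =
      if k.1^2 + k.2.1^2 ≠ 0 then
        ((Ra * (((k.1:ℝ)/L) * (k.2.2:ℝ) / (((k.2.2:ℝ))^2 + kappa L k ^ 3)) : ℝ) : ℂ) * a k
      else 0)
    (hw : ∀ k : ℤ × ℤ × ℤ, w k =
      if k.1^2 + k.2.1^2 ≠ 0 then
        ((Ra * (kappa L k ^ 2 / (((k.2.2:ℝ))^2 + kappa L k ^ 3)) : ℝ) : ℂ) * a k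
      else 0) :
    ((Summable fun k : ℤ × ℤ × ℤ => kappa L k ^ 2 * ‖a k‖^2) →
      ∑' k : ℤ × ℤ × ℤ, kappa L k * ((k.2.2:ℝ))^2 * (‖u k‖^2 + ‖v k‖^2 + ‖w k‖^2)
        ≤ 2 * Ra^2 * ∑' k : ℤ × ℤ × ℤ, kappa L k ^ 2 * ‖a k‖^2) ∧
    ((Summable fun k : ℤ × ℤ × ℤ => kappa L k * ((k.2.2:ℝ))^2 * ‖a k‖^2) →
      ∑' k : ℤ × ℤ × ℤ, ((k.2.2:ℝ))^4 * (‖u k‖^2 + ‖v k‖^2 + ‖w k‖^2)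
        ≤ 2 * Ra^2 * ∑' k : ℤ × ℤ × ℤ, kappa L k * ((k.2.2:ℝ))^2 * ‖a k‖^2) := by
  have key : ∀ k : ℤ × ℤ × ℤ, ((k.2.2:ℝ))^2 * (‖u k‖^2 + ‖v k‖^2 + ‖w k‖^2)
      ≤ Ra^2 * (kappa L k * ‖a k‖^2) := by
    intro k
    by_cases hk : k.1^2 + k.2.1^2 = 0
    · simp [hu k, hv k, hw k, hk, ha0 k hk]
    · have hxy : ((k.1:ℝ)/L)^2 + ((k.2.1:ℝ)/L)^2 = kappa L k := by
        unfold kappa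
        push_cast
        ring
      have h := mul_le_mul_of_nonneg_right
        (sq_mul_multipliers_le (R := Ra) (p := (k.2.2:ℝ)) (kappa_pos hL hk) hxy)
        (sq_nonneg ‖a k‖)
      rw [hu k, hv k, hw k, if_pos hk, if_pos hk, if_pos hk]
      simp only [norm_ofReal_mul_sq]
      linarith
  have hκ := kappa_nonneg L
  refine ⟨tsum_le_two_mul_sq_mul_tsum Ra (fun k => ?_) (fun k => by positivity) (fun k => ?_),
    tsum_le_two_mul_sq_mul_tsum Ra (fun k => by positivity) (fun k => ?_) (fun k => ?_)⟩
  · have := hκ k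
    positivity
  · linarith [mul_le_mul_of_nonneg_left (key k) (hκ k)]
  · have := hκ k
    positivity
  · linarith [mul_le_mul_of_nonneg_left (key k) (sq_nonneg (k.2.2:ℝ))]
end
end

section
/- Let L > 0, let w and θ' be smooth Ω-periodic functions on ℝ³, and let θ̄ : ℝ → ℝ be a smooth 2π-periodic function such that θ̄''(z) = (d/dz)( \overline{θ' w}(z) ) for all z ∈ ℝ. Then −(1/(4π²L²)) ∫_Ω w(x,y,z) θ̄''(z) ∂_z θ'(x,y,z) dx dy dz ≤ −(1/2) ∫₀^{2π} ( \overline{w ∂_z θ'}(z) )² dz + (1/2) ∫₀^{2π} ( \overline{θ' ∂_z w}(z) )² dz. -/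
noncomputable section
open Real

/-- `f` is periodic with period `2πL` in the first two variables and `2π` in the third. -/
def OmegaPeriodic (L : ℝ) (f : ℝ → ℝ → ℝ → ℝ) : Prop :=
  (∀ x y z, f (x + 2*π*L) y z = f x y z) ∧
  (∀ x y z, f x (y + 2*π*L) z = f x y z) ∧
  (∀ x y z, f x y (z + 2*π) = f x y z)

/-- Smoothness of a function of three real variables. -/
def Smooth3 (f : ℝ → ℝ → ℝ → ℝ) : Prop :=
  ContDiff ℝ (⊤ : ℕ∞) (fun p : ℝ × ℝ × ℝ => f p.1 p.2.1 p.2.2)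

/-- Integral over the fundamental domain `Ω = [0,2πL]² × [0,2π]`. -/
def intOmega (L : ℝ) (g : ℝ → ℝ → ℝ → ℝ) : ℝ :=
  ∫ z in (0:ℝ)..(2*π), ∫ y in (0:ℝ)..(2*π*L), ∫ x in (0:ℝ)..(2*π*L), g x y z

def pdz (f : ℝ → ℝ → ℝ → ℝ) (x y z : ℝ) : ℝ := deriv (fun s => f x y s) z

/-- The horizontal mean of `f` at height `z`. -/
def hmean (L : ℝ) (f : ℝ → ℝ → ℝ → ℝ) (z : ℝ) : ℝ :=
  (1/(4*π^2*L^2)) * ∫ y in (0:ℝ)..(2*π*L), ∫ x in (0:ℝ)..(2*π*L), f x y z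

/-- Differentiation under the integral sign for an interval integral with continuous data. -/
theorem hasDerivAt_intervalIntegral_of_continuous {F F' : ℝ → ℝ → ℝ}
    (hF : Continuous F.uncurry) (hF' : Continuous F'.uncurry)
    (hd : ∀ s t, HasDerivAt (fun s => F s t) (F' s t) s) (a b s : ℝ) :
    HasDerivAt (fun s => ∫ t in a..b, F s t) (∫ t in a..b, F' s t) s := by
  obtain ⟨C, hC⟩ := ((isCompact_closedBall s 1).prod
    (isCompact_uIcc (a := a) (b := b))).exists_bound_of_continuousOn hF'.continuousOn
  have hs (s : ℝ) : Continuous (F s) := hF.comp (Continuous.prodMk_right s)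
  have hs' (s : ℝ) : Continuous (F' s) := hF'.comp (Continuous.prodMk_right s)
  refine (intervalIntegral.hasDerivAt_integral_of_dominated_loc_of_deriv_le
    (bound := fun _ => C) (Metric.closedBall_mem_nhds s one_pos)
    (Filter.Eventually.of_forall fun s => (hs s).aestronglyMeasurable)
    ((hs s).intervalIntegrable a b) (hs' s).aestronglyMeasurable ?_
    intervalIntegrable_const ?_).2
  · exact Filter.Eventually.of_forall fun t ht r hr =>
      hC (r, t) ⟨hr, Set.uIoc_subset_uIcc ht⟩
  · exact Filter.Eventually.of_forall fun t _ r _ => hd r t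

theorem Smooth3.hasDerivAt_pdz {f : ℝ → ℝ → ℝ → ℝ} (hf : Smooth3 f) (x y z : ℝ) :
    HasDerivAt (fun s => f x y s) (pdz f x y z) z := by
  have h : ContDiff ℝ (⊤ : ℕ∞) (fun s => f x y s) :=
    ContDiff.comp (g := fun p : ℝ × ℝ × ℝ => f p.1 p.2.1 p.2.2) (f := fun s : ℝ => (x, y, s))
      hf (by fun_prop)
  exact (h.differentiable (by simp) z).hasDerivAt

theorem Smooth3.continuous {f : ℝ → ℝ → ℝ → ℝ} (hf : Smooth3 f) :
    Continuous (fun p : ℝ × ℝ × ℝ => f p.1 p.2.1 p.2.2) :=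
  ContDiff.continuous hf

theorem Smooth3.continuous_pdz {f : ℝ → ℝ → ℝ → ℝ} (hf : Smooth3 f) :
    Continuous (fun p : ℝ × ℝ × ℝ => pdz f p.1 p.2.1 p.2.2) := by
  have h : (fun p : ℝ × ℝ × ℝ => pdz f p.1 p.2.1 p.2.2) =
      fun p => fderiv ℝ (fun p : ℝ × ℝ × ℝ => f p.1 p.2.1 p.2.2) p (0, 0, 1) := by
    funext p
    have h₁ : HasFDerivAt (fun p : ℝ × ℝ × ℝ => f p.1 p.2.1 p.2.2)
        (fderiv ℝ (fun p : ℝ × ℝ × ℝ => f p.1 p.2.1 p.2.2) p) (p.1, p.2.1, p.2.2) :=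
      (ContDiff.differentiable hf (by simp) p).hasFDerivAt
    have h₂ : HasDerivAt (fun s : ℝ => (p.1, p.2.1, s)) ((0 : ℝ), (0 : ℝ), (1 : ℝ)) p.2.2 :=
      (hasDerivAt_const _ _).prodMk ((hasDerivAt_const _ _).prodMk (hasDerivAt_id _))
    exact (h₁.comp_hasDerivAt p.2.2 h₂).deriv
  rw [h]
  exact (ContDiff.continuous_fderiv hf (by simp)).clm_apply continuous_const

theorem continuous_hmean (L : ℝ) {f : ℝ → ℝ → ℝ → ℝ}
    (hf : Continuous (fun p : ℝ × ℝ × ℝ => f p.1 p.2.1 p.2.2)) : Continuous (hmean L f) := by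
  refine continuous_const.mul
    (intervalIntegral.continuous_parametric_intervalIntegral_of_continuous' ?_ _ _)
  refine intervalIntegral.continuous_parametric_intervalIntegral_of_continuous'
    (f := fun (q : ℝ × ℝ) x => f x q.2 q.1) ?_ _ _
  exact hf.comp (f := fun q : (ℝ × ℝ) × ℝ => (q.2, q.1.2, q.1.1)) (by fun_prop)

/-- The horizontal mean commutes with the vertical derivative. -/
theorem hasDerivAt_hmean (L : ℝ) {f f' : ℝ → ℝ → ℝ → ℝ}
    (hf : Continuous (fun p : ℝ × ℝ × ℝ => f p.1 p.2.1 p.2.2))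
    (hf' : Continuous (fun p : ℝ × ℝ × ℝ => f' p.1 p.2.1 p.2.2))
    (hd : ∀ x y z, HasDerivAt (fun s => f x y s) (f' x y z) z) (z : ℝ) :
    HasDerivAt (hmean L f) (hmean L f' z) z := by
  have key {g : ℝ → ℝ → ℝ → ℝ} (hg : Continuous (fun p : ℝ × ℝ × ℝ => g p.1 p.2.1 p.2.2)) :
      Continuous (Function.uncurry fun z y => ∫ x in (0:ℝ)..(2*π*L), g x y z) := by
    refine intervalIntegral.continuous_parametric_intervalIntegral_of_continuous'
      (f := fun (q : ℝ × ℝ) x => g x q.2 q.1) ?_ _ _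
    exact hg.comp (f := fun q : (ℝ × ℝ) × ℝ => (q.2, q.1.2, q.1.1)) (by fun_prop)
  refine (hasDerivAt_intervalIntegral_of_continuous (key hf) (key hf') (fun z y => ?_)
    _ _ z).const_mul _
  refine hasDerivAt_intervalIntegral_of_continuous (F := fun z x => f x y z)
    (F' := fun z x => f' x y z) ?_ ?_ (fun z x => hd x y z) _ _ z
  · exact hf.comp (f := fun q : ℝ × ℝ => (q.2, y, q.1)) (by fun_prop)
  · exact hf'.comp (f := fun q : ℝ × ℝ => (q.2, y, q.1)) (by fun_prop)

theorem hmean_add (L : ℝ) {f g : ℝ → ℝ → ℝ → ℝ}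
    (hf : Continuous (fun p : ℝ × ℝ × ℝ => f p.1 p.2.1 p.2.2))
    (hg : Continuous (fun p : ℝ × ℝ × ℝ => g p.1 p.2.1 p.2.2)) (z : ℝ) :
    hmean L (fun x y z => f x y z + g x y z) z = hmean L f z + hmean L g z := by
  have inner {h : ℝ → ℝ → ℝ → ℝ} (hh : Continuous (fun p : ℝ × ℝ × ℝ => h p.1 p.2.1 p.2.2))
      (y : ℝ) : Continuous fun x => h x y z :=
    hh.comp (f := fun x : ℝ => (x, y, z)) (by fun_prop)
  have outer {h : ℝ → ℝ → ℝ → ℝ} (hh : Continuous (fun p : ℝ × ℝ × ℝ => h p.1 p.2.1 p.2.2)) :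
      Continuous fun y => ∫ x in (0:ℝ)..(2*π*L), h x y z := by
    refine intervalIntegral.continuous_parametric_intervalIntegral_of_continuous'
      (f := fun y x => h x y z) ?_ _ _
    exact hh.comp (f := fun q : ℝ × ℝ => (q.2, q.1, z)) (by fun_prop)
  unfold hmean
  rw [← mul_add, ← intervalIntegral.integral_add ((outer hf).intervalIntegrable _ _)
    ((outer hg).intervalIntegrable _ _)]
  congr 2
  funext y
  exact intervalIntegral.integral_add ((inner hf y).intervalIntegrable _ _)
    ((inner hg y).intervalIntegrable _ _)

/-- A factor depending on the height only comes out of the horizontal integral. -/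
theorem mean_intOmega_eq (L : ℝ) (f g : ℝ → ℝ → ℝ → ℝ) (c : ℝ → ℝ) :
    (1/(4*π^2*L^2)) * intOmega L (fun x y z => f x y z * c z * g x y z) =
      ∫ z in (0:ℝ)..(2*π), c z * hmean L (fun x y z => f x y z * g x y z) z := by
  unfold intOmega hmean
  rw [← intervalIntegral.integral_const_mul]
  congr 1
  funext z
  simp only [mul_right_comm _ (c z), intervalIntegral.integral_mul_const]
  ring

/-- Sign structure of the dangerous term in the `‖∂_z θ'‖₂` estimate. -/
theorem dangerous_term_sign_structure (L : ℝ) (hL : 0 < L)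
    (w θ' : ℝ → ℝ → ℝ → ℝ) (θb : ℝ → ℝ)
    (hw : Smooth3 w) (hwp : OmegaPeriodic L w)
    (hθ : Smooth3 θ') (hθp : OmegaPeriodic L θ')
    (hθb : ContDiff ℝ (⊤ : ℕ∞) θb) (hθbp : Function.Periodic θb (2*π))
    (heq : ∀ z : ℝ,
      deriv (deriv θb) z
        = deriv (fun s => hmean L (fun x y z' => θ' x y z' * w x y z') s) z) :
    -(1/(4*π^2*L^2)) * intOmega L
        (fun x y z => w x y z * deriv (deriv θb) z * pdz θ' x y z)
      ≤ -(1/2) * (∫ z in (0:ℝ)..(2*π),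
            (hmean L (fun x y z' => w x y z' * pdz θ' x y z') z)^2)
        + (1/2) * ∫ z in (0:ℝ)..(2*π),
            (hmean L (fun x y z' => θ' x y z' * pdz w x y z') z)^2 := by
  set A := hmean L (fun x y z' => w x y z' * pdz θ' x y z') with hA
  set B := hmean L (fun x y z' => θ' x y z' * pdz w x y z') with hB
  have cA' := hw.continuous.mul hθ.continuous_pdz
  have cB' := hθ.continuous.mul hw.continuous_pdz
  have cA : Continuous A := continuous_hmean L cA'
  have cB : Continuous B := continuous_hmean L cB'
  have hsum (z : ℝ) : deriv (deriv θb) z = A z + B z := by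
    rw [heq z, hA, hB, ← hmean_add L cA' cB' z]
    refine (hasDerivAt_hmean L (hθ.continuous.mul hw.continuous) (cA'.add cB')
      (fun x y z => ?_) z).deriv
    exact ((hθ.hasDerivAt_pdz x y z).mul (hw.hasDerivAt_pdz x y z)).congr_deriv (by ring)
  rw [neg_mul, mean_intOmega_eq]
  simp only [hsum]
  rw [← intervalIntegral.integral_neg, ← intervalIntegral.integral_const_mul,
    ← intervalIntegral.integral_const_mul, ← intervalIntegral.integral_add
      (Continuous.intervalIntegrable (by fun_prop) _ _)
      (Continuous.intervalIntegrable (by fun_prop) _ _)]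
  refine intervalIntegral.integral_mono_on (by positivity)
    (((cA.add cB).mul cA).neg.intervalIntegrable _ _)
    (Continuous.intervalIntegrable (by fun_prop) _ _) fun z _ => ?_
  nlinarith [sq_nonneg (A z + B z)]
end
end
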